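/- Let d ≥ 1, let λ be a partition of n ≥ 1, and let μ be a partition of dn. Then d! divides the character value χ^{⊞^d(λ)}_{d·μ}. -/

import Mathlib

open MvPolynomial Finset

/-- The `r`-th power sum polynomial `p_r = x_1^r + ⋯ + x_N^r`. -/
noncomputable def psum (N r : ℕ) : MvPolynomial (Fin N) ℤ := ∑ i, X i ^ r

/-- The power sum product `p_μ = p_{μ_1} ⋯ p_{μ_k}` for a partition `μ`. -/
noncomputable def pprod (N : ℕ) {n : ℕ} (mu : Nat.Partition n) : MvPolynomial (Fin N) ℤ :=
  (mu.parts.map (psum N)).prod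

/-- The Vandermonde product `∏_{i<j} (x_i - x_j)`. -/
noncomputable def vandermonde (N : ℕ) : MvPolynomial (Fin N) ℤ :=
  ∏ p ∈ univ.filter (fun p : Fin N × Fin N => p.1 < p.2), (X p.1 - X p.2)

/-- The irreducible character value `χ^λ_μ` of `S_N`, via the Frobenius character formula:
the coefficient of `x_1^{λ_1 + N - 1} x_2^{λ_2 + N - 2} ⋯ x_N^{λ_N}` in `∏_{i<j}(x_i - x_j) ⋅ p_μ`,
where `λ` is padded with trailing zeros to length `N`. -/
noncomputable def chi {N : ℕ} (l m : Nat.Partition N) : ℤ :=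
  coeff (Finsupp.equivFunOnFinite.symm fun i : Fin N =>
    (l.parts.sort (· ≥ ·)).getD i 0 + (N - 1 - (i : ℕ))) (vandermonde N * pprod N m)

/-- `⊞^d(λ)`: replace each part `p` of `λ` by `d` copies of `d⋅p`; a partition of `d²n`. -/
def boxplus (d : ℕ) {n : ℕ} (P : Nat.Partition n) : Nat.Partition (d * (d * n)) where
  parts := P.parts.bind fun p => Multiset.replicate d (d * p)
  parts_pos := by
    intro i hi
    simp only [Multiset.mem_bind, Multiset.mem_replicate] at hi
    obtain ⟨p, hp, hd, rfl⟩ := hi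
    exact Nat.mul_pos (Nat.pos_of_ne_zero hd) (P.parts_pos hp)
  parts_sum := by
    rw [Multiset.sum_bind]
    simp only [Multiset.sum_replicate, smul_eq_mul]
    rw [Multiset.sum_map_mul_left, Multiset.sum_map_mul_left, Multiset.map_id', P.parts_sum]

/-- `d⋅λ`: multiply every part of `λ` by `d`; a partition of `dn`. -/
def scale (d : ℕ) (hd : 0 < d) {n : ℕ} (P : Nat.Partition n) : Nat.Partition (d * n) where
  parts := P.parts.map (d * ·)
  parts_pos := by
    intro i hi
    obtain ⟨p, hp, rfl⟩ := Multiset.mem_map.mp hi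
    exact Nat.mul_pos hd (P.parts_pos hp)
  parts_sum := by rw [Multiset.sum_map_mul_left, Multiset.map_id', P.parts_sum]

theorem MulAction.card_dvd_sum {G Y : Type*} [Group G] [Fintype G] [Fintype Y] [MulAction G Y]
    (F : Y → ℤ) (hF : ∀ (g : G) (y : Y), F (g • y) = F y)
    (hfree : ∀ y, F y ≠ 0 → ∀ g : G, g • y = y → g = 1) :
    (Fintype.card G : ℤ) ∣ ∑ y, F y := by
  classical
  rw [← (MulAction.selfEquivSigmaOrbits G Y).symm.sum_comp, Fintype.sum_sigma]
  refine Finset.dvd_sum fun ω _ => ?_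
  have hconst : ∀ y : MulAction.orbit G (Quotient.out ω),
      F ((MulAction.selfEquivSigmaOrbits G Y).symm ⟨ω, y⟩) = F (Quotient.out ω) := by
    rintro ⟨_, g, rfl⟩
    exact hF g _
  rw [Finset.sum_congr rfl fun y _ => hconst y, Finset.sum_const, Finset.card_univ, nsmul_eq_mul]
  by_cases h0 : F (Quotient.out ω) = 0
  · simp [h0]
  have hstab : MulAction.stabilizer G (Quotient.out ω) = ⊥ :=
    (Subgroup.eq_bot_iff_forall _).2 fun g hg => hfree _ h0 g hg
  have hcard := MulAction.card_orbit_mul_card_stabilizer_eq_card_group G (Quotient.out ω)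
  have hone : Fintype.card (MulAction.stabilizer G (Quotient.out ω)) = 1 := by
    rw [← Nat.card_eq_fintype_card, hstab, Subgroup.card_bot]
  rw [hone, mul_one] at hcard
  rw [← hcard]
  exact dvd_mul_right _ _

theorem vandermonde_eq_det (N : ℕ) :
    vandermonde N =
      (Matrix.of fun i j : Fin N => (X i : MvPolynomial (Fin N) ℤ) ^ (N - 1 - (j : ℕ))).det := by
  have h := Matrix.det_projVandermonde (1 : Fin N → MvPolynomial (Fin N) ℤ) X
  have hmat : Matrix.projVandermonde (1 : Fin N → MvPolynomial (Fin N) ℤ) X =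
      Matrix.of fun i j : Fin N => (X i : MvPolynomial (Fin N) ℤ) ^ (N - 1 - (j : ℕ)) := by
    ext1 i j
    rw [Matrix.projVandermonde_apply]
    simp only [Pi.one_apply, one_pow, one_mul, Matrix.of_apply, Fin.val_rev]
    congr 1
    omega
  rw [← hmat, h, vandermonde, Finset.prod_filter, Fintype.prod_prod_type]
  refine Finset.prod_congr rfl fun i _ => ?_
  rw [← Finset.prod_filter]
  refine Finset.prod_congr ?_ fun j _ => by simp
  ext j
  simp

theorem prod_X_pow_eq_monomial {N : ℕ} (a : Fin N → ℕ) :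
    ∏ i, (X i : MvPolynomial (Fin N) ℤ) ^ a i =
      monomial (Finsupp.equivFunOnFinite.symm a) 1 := by
  rw [monomial_eq, Finsupp.prod_fintype _ _ fun _ => pow_zero _]
  simp

/-- The coefficient of a monomial in a generalized Vandermonde determinant times a monomial. -/
theorem coeff_det_mul_prod_X_pow {N : ℕ} (a b w : Fin N → ℕ) :
    coeff (Finsupp.equivFunOnFinite.symm a)
      ((Matrix.of fun i j : Fin N => (X i : MvPolynomial (Fin N) ℤ) ^ b j).det *
        ∏ i, X i ^ w i) =
      (Matrix.of fun i j : Fin N => if a i = b j + w i then (1 : ℤ) else 0).det := by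
  rw [← Matrix.det_transpose, ← Matrix.det_transpose (Matrix.of fun i j : Fin N => ite _ _ _),
    Matrix.det_apply', Matrix.det_apply', Finset.sum_mul, coeff_sum]
  refine Finset.sum_congr rfl fun σ _ => ?_
  simp only [Matrix.transpose_apply, Matrix.of_apply]
  rw [mul_assoc, ← Finset.prod_mul_distrib]
  simp only [← pow_add]
  rw [prod_X_pow_eq_monomial, ← map_intCast (C : ℤ →+* MvPolynomial (Fin N) ℤ), coeff_C_mul,
    coeff_monomial, Fintype.prod_boole]
  simp only [Int.cast_id, EmbeddingLike.apply_eq_iff_eq, funext_iff]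
  congr 2
  simp only [eq_comm]

theorem pprod_eq_sum {N n k : ℕ} (m : Nat.Partition n) (f : Fin k → ℕ)
    (hf : m.parts = Multiset.ofList (List.ofFn f)) :
    pprod N m = ∑ g : Fin k → Fin N, ∏ i, X i ^ (∑ t with g t = i, f t) := by
  rw [pprod, hf, Multiset.map_coe, Multiset.prod_coe, List.map_ofFn, List.prod_ofFn]
  simp only [Function.comp_apply, _root_.psum]
  rw [Finset.prod_univ_sum, Fintype.piFinset_univ]
  refine Finset.sum_congr rfl fun g _ => ?_
  rw [← Finset.prod_fiberwise univ g]
  refine Finset.prod_congr rfl fun i _ => ?_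
  rw [← Finset.prod_pow_eq_pow_sum]
  exact Finset.prod_congr rfl fun t ht => by rw [(Finset.mem_filter.1 ht).2]

theorem chi_eq_sum_det {N k : ℕ} (l m : Nat.Partition N) (f : Fin k → ℕ)
    (hf : m.parts = Multiset.ofList (List.ofFn f)) :
    chi l m = ∑ g : Fin k → Fin N,
      (Matrix.of fun i j : Fin N =>
        if (l.parts.sort (· ≥ ·)).getD i 0 + (N - 1 - (i : ℕ)) =
          (N - 1 - (j : ℕ)) + ∑ t with g t = i, f t then (1 : ℤ) else 0).det := by
  rw [chi, vandermonde_eq_det, pprod_eq_sum m f hf, Finset.mul_sum, coeff_sum]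
  exact Finset.sum_congr rfl fun g _ => coeff_det_mul_prod_X_pow _ _ _

theorem List.getD_flatMap_replicate (d : ℕ) (l : List ℕ) (q r : ℕ) (hr : r < d) :
    (l.flatMap fun p => List.replicate d (d * p)).getD (r + d * q) 0 = d * l.getD q 0 := by
  induction l generalizing q with
  | nil => simp
  | cons p l ih =>
    rw [List.flatMap_cons]
    cases q with
    | zero =>
      rw [List.getD_append _ _ _ _ (by simpa using hr)]
      simp [List.getD_eq_getElem?_getD, hr]
    | succ q =>
      rw [List.getD_append_right _ _ _ _ (by simp [Nat.mul_add]; omega), List.getD_cons_succ,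
        ← ih q]
      congr 1
      simp only [List.length_replicate, Nat.mul_add]
      omega

theorem sort_boxplus_parts (d : ℕ) {n : ℕ} (P : Nat.Partition n) :
    (boxplus d P).parts.sort (· ≥ ·) =
      (P.parts.sort (· ≥ ·)).flatMap fun p => List.replicate d (d * p) := by
  refine List.Perm.eq_of_pairwise' (r := (· ≥ ·)) (Multiset.pairwise_sort _ _) ?_ ?_
  · rw [List.pairwise_flatMap]
    refine ⟨fun a _ => List.pairwise_replicate.2 (Or.inr le_rfl), ?_⟩
    refine (Multiset.pairwise_sort P.parts (· ≥ ·)).imp fun {a b} hab x hx y hy => ?_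
    rw [List.eq_of_mem_replicate hx, List.eq_of_mem_replicate hy]
    exact Nat.mul_le_mul_left d hab
  · rw [← Multiset.coe_eq_coe, Multiset.sort_eq, ← Multiset.coe_bind, Multiset.sort_eq]
    rfl

theorem getD_sort_parts_zero_pos {n : ℕ} (hn : 1 ≤ n) (P : Nat.Partition n) :
    0 < (P.parts.sort (· ≥ ·)).getD 0 0 := by
  have hmem : ∀ p ∈ P.parts.sort (· ≥ ·), 0 < p :=
    fun p hp => P.parts_pos ((Multiset.mem_sort _).1 hp)
  have hsum : (P.parts.sort (· ≥ ·)).sum = n := by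
    rw [← Multiset.sum_coe, Multiset.sort_eq, P.parts_sum]
  cases h : P.parts.sort (· ≥ ·) with
  | nil => simp [h] at hsum; omega
  | cons p l => exact hmem p (by simp [h])

/-- A matrix indexed by `Fin (M * d)` that only pairs indices of the same residue modulo `d`
has a determinant that factors over the residues. -/
theorem det_eq_prod_det_residue {M d N : ℕ} (e : Fin M × Fin d ≃ Fin N)
    (a b : Fin M → ℕ) (w : Fin N → ℕ) (α β : Fin N → ℕ)
    (hα : ∀ q r, α (e (q, r)) = d * a q + (d - 1 - (r : ℕ)))
    (hβ : ∀ q r, β (e (q, r)) = d * b q + (d - 1 - (r : ℕ))) :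
    (Matrix.of fun i j : Fin N => if α i = β j + d * w i then (1 : ℤ) else 0).det =
      ∏ r : Fin d, (Matrix.of fun p q : Fin M =>
        if a p = b q + w (e (p, r)) then (1 : ℤ) else 0).det := by
  rw [← Matrix.det_submatrix_equiv_self e, ← Matrix.det_blockDiagonal]
  congr 1
  ext ⟨p, r⟩ ⟨q, s⟩
  rw [Matrix.blockDiagonal_apply]
  simp only [Matrix.submatrix_apply, Matrix.of_apply, hα, hβ]
  have hr := r.isLt
  have hs := s.isLt
  rw [← ite_and]
  refine if_congr ?_ rfl rfl
  constructor
  · intro h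
    have h' : (d - 1 - (r : ℕ)) + d * a p =
        (d - 1 - (s : ℕ)) + d * (b q + w (e (p, r))) := by
      rw [Nat.mul_add]; omega
    have hmod := congrArg (· % d) h'
    simp only [Nat.add_mul_mod_self_left] at hmod
    rw [Nat.mod_eq_of_lt (by omega), Nat.mod_eq_of_lt (by omega)] at hmod
    rw [hmod] at h'
    exact ⟨Fin.ext (by omega), Nat.eq_of_mul_eq_mul_left (by omega) (Nat.add_left_cancel h')⟩
  · rintro ⟨rfl, h⟩
    rw [h, Nat.mul_add]
    omega

/-- Summing over all colourings of a finite set by `d` colours a product over the colours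
that vanishes unless every colour is used gives a multiple of `d!`. -/
theorem factorial_dvd_sum_prod_colouring {ι : Type*} [Fintype ι] [DecidableEq ι] (d : ℕ)
    (c : Finset ι → ℤ) (hc : c ∅ = 0) :
    (d.factorial : ℤ) ∣ ∑ f : ι → Fin d, ∏ r, c {t | f t = r} := by
  have hcard : Fintype.card (Equiv.Perm (Fin d)) = d.factorial := by
    rw [Fintype.card_perm, Fintype.card_fin]
  rw [← hcard]
  refine MulAction.card_dvd_sum (G := Equiv.Perm (Fin d)) _ (fun σ f => ?_) fun f hf σ hσ => ?_
  · rw [← Equiv.prod_comp σ]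
    simp
  · ext1 r
    have hne : c {t | f t = r} ≠ 0 := Finset.prod_ne_zero_iff.1 hf r (Finset.mem_univ r)
    obtain ⟨t, ht⟩ : (univ.filter fun t => f t = r).Nonempty := by
      rw [Finset.nonempty_iff_ne_empty]
      intro h
      exact hne (by rw [h, hc])
    have htr : f t = r := (Finset.mem_filter.1 ht).2
    rw [← htr]
    exact congrFun hσ t

/-- **Miller's congruence** (first part of Theorem 2): for `d ≥ 1`, `λ ⊢ n ≥ 1` and
`μ ⊢ dn`, we have `χ^{⊞^d(λ)}_{d·μ} ≡ 0 (mod d!)`. -/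
theorem factorial_dvd_boxplus_char_value (d n : ℕ) (hd : 1 ≤ d) (hn : 1 ≤ n)
    (lam : Nat.Partition n) (mu : Nat.Partition (d * n)) :
    (d.factorial : ℤ) ∣ chi (boxplus d lam) (scale d hd mu) := by
  obtain ⟨k, m, hm⟩ : ∃ (k : ℕ) (m : Fin k → ℕ), mu.parts = Multiset.ofList (List.ofFn m) :=
    ⟨_, (mu.parts.sort (· ≥ ·)).get, by rw [List.ofFn_get, Multiset.sort_eq]⟩
  have hscale : (scale d hd mu).parts = Multiset.ofList (List.ofFn fun t => d * m t) := by
    change mu.parts.map (d * ·) = _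
    rw [hm, Multiset.map_coe, List.map_ofFn]
    rfl
  let M := d * n
  let e : Fin M × Fin d ≃ Fin (d * M) := finProdFinEquiv.trans (finCongr (mul_comm M d))
  have he : ∀ q r, (e (q, r) : ℕ) = r + d * q := fun q r => by simp [e]
  let a : Fin M → ℕ := fun q => (lam.parts.sort (· ≥ ·)).getD q 0 + (M - 1 - (q : ℕ))
  let b : Fin M → ℕ := fun q => M - 1 - (q : ℕ)
  have hβ : ∀ q r, d * M - 1 - (e (q, r) : ℕ) = d * b q + (d - 1 - (r : ℕ)) := fun q r => by
    obtain ⟨j, hj⟩ : ∃ j, M = q + 1 + j := Nat.exists_eq_add_of_le q.isLt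
    have hb : b q = j := by simp only [b]; omega
    have hr := r.isLt
    have hdM : d * M = d * q + d + d * j :=
      (congrArg (d * ·) hj).trans (by ring)
    rw [he, hb, hdM]
    omega
  have hα : ∀ q r, ((boxplus d lam).parts.sort (· ≥ ·)).getD (e (q, r)) 0 +
      (d * M - 1 - (e (q, r) : ℕ)) = d * a q + (d - 1 - (r : ℕ)) := fun q r => by
    rw [hβ, he, sort_boxplus_parts, List.getD_flatMap_replicate _ _ _ _ r.isLt]
    simp only [a, b, Nat.mul_add]
    omega
  rw [chi_eq_sum_det _ _ _ hscale]
  simp only [← Finset.mul_sum]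
  rw [Finset.sum_congr rfl fun g _ => det_eq_prod_det_residue e a b
    (fun i => ∑ t with g t = i, m t) _ _ hα hβ]
  rw [← (Equiv.arrowCongr (Equiv.refl (Fin k)) e).sum_comp,
    ← (Equiv.arrowProdEquivProdArrow (Fin k) (fun _ => Fin M) (fun _ => Fin d)).symm.sum_comp,
    Fintype.sum_prod_type]
  refine Finset.dvd_sum fun h _ => ?_
  have key := factorial_dvd_sum_prod_colouring (ι := Fin k) d (fun S =>
    (Matrix.of fun p q : Fin M => if a p = b q + ∑ t ∈ S with h t = p, m t then (1 : ℤ) else 0).det) ?_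
  · refine key.trans (dvd_of_eq ?_)
    refine Finset.sum_congr rfl fun f _ => Finset.prod_congr rfl fun r _ => ?_
    congr 1
    ext p q
    simp [Equiv.arrowProdEquivProdArrow, Finset.filter_filter, and_comm]
  · have hM : 0 < M := Nat.mul_pos hd hn
    refine Matrix.det_eq_zero_of_row_eq_zero ⟨0, hM⟩ fun q => ?_
    have hpos := getD_sort_parts_zero_pos hn lam
    simp only [Matrix.of_apply, Finset.filter_empty, Finset.sum_empty]
    refine if_neg ?_
    simp only [a, b]
    omega
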